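/- Let A and B be positive definite k×k real matrices with A ≤ B in the sense of quadratic forms. Let μ_A and μ_B denote the probability measures on Z^k with μ_A(m) ∝ exp(−(1/2)⟨m, A m⟩) and similarly for B. Then for every v ∈ R^k, E_{μ_B}[exp(⟨v, ψ⟩)] ≤ E_{μ_A}[exp(⟨v, ψ⟩)]; in particular E_{μ_B}[⟨v,ψ⟩²] ≤ E_{μ_A}[⟨v,ψ⟩²]. -/

import Mathlib

open scoped BigOperators

/-- The pairing `⟨v, m⟩ = ∑ i, v i · m i` between a real vector and an integer
vector. -/
noncomputable def intDot {k : ℕ} (v : Fin k → ℝ) (m : Fin k → ℤ) : ℝ :=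
  ∑ i, v i * (m i : ℝ)

/-- The quadratic form `⟨m, A m⟩` of an integer vector. -/
noncomputable def intQuad {k : ℕ} (A : Matrix (Fin k) (Fin k) ℝ)
    (m : Fin k → ℤ) : ℝ :=
  ∑ i, ∑ j, (m i : ℝ) * A i j * (m j : ℝ)

/-- The expectation of `f` under the integer Gaussian measure on `ℤ^k`
associated to the positive definite matrix `A`, assigning to each `m ∈ ℤ^k`
mass proportional to `exp(−(1/2)⟨m, A m⟩)`. -/
noncomputable def intGaussExp {k : ℕ} (A : Matrix (Fin k) (Fin k) ℝ)
    (f : (Fin k → ℤ) → ℝ) : ℝ :=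
  (∑' m : Fin k → ℤ, f m * Real.exp (-(1 / 2) * intQuad A m)) /
    (∑' m : Fin k → ℤ, Real.exp (-(1 / 2) * intQuad A m))

lemma psd_pow {ι κ γ : Type*} [Fintype κ] [Fintype γ] [DecidableEq γ] (s : Finset ι) (a : ι → ℝ)
    (d : ι → γ) (L : ι → κ → ℝ) (n : ℕ) :
    0 ≤ ∑ x ∈ s ×ˢ s, if d x.1 = d x.2 then
      a x.1 * a x.2 * (∑ i, L x.1 i * L x.2 i) ^ n else 0 := by
  have h : (∑ x ∈ s ×ˢ s, if d x.1 = d x.2 then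
      a x.1 * a x.2 * (∑ i, L x.1 i * L x.2 i) ^ n else 0)
      = ∑ c : γ, ∑ σ : Fin n → κ, (∑ p ∈ s, if d p = c then a p * ∏ i, L p (σ i) else 0) ^ 2 := by
    have e : ∀ (c : γ) (σ : Fin n → κ),
        (∑ p ∈ s, if d p = c then a p * ∏ i, L p (σ i) else 0) ^ 2 =
        ∑ x ∈ s ×ˢ s, (if d x.1 = c then a x.1 * ∏ i, L x.1 (σ i) else 0) *
          (if d x.2 = c then a x.2 * ∏ i, L x.2 (σ i) else 0) := fun c σ => by
      rw [sq, Finset.sum_mul_sum, Finset.sum_product]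
    rw [Finset.sum_congr rfl (fun c _ => Finset.sum_congr rfl (fun σ _ => e c σ)),
      Finset.sum_congr rfl (fun c _ => Finset.sum_comm), Finset.sum_comm]
    refine Finset.sum_congr rfl fun x _ => ?_
    rw [Finset.sum_eq_single (d x.1)]
    · by_cases hx : d x.1 = d x.2
      · simp only [hx, if_true, Fintype.sum_pow, Finset.mul_sum, Finset.prod_mul_distrib]
        refine Finset.sum_congr rfl fun σ _ => by ring
      · have hx' : ¬ d x.2 = d x.1 := fun h => hx h.symm
        simp [hx, hx']
    · intro c _ hc
      simp [hc.symm]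
    · simp
  rw [h]
  positivity

lemma psd_sinh {ι κ γ : Type*} [Fintype κ] [Fintype γ] [DecidableEq γ] (s : Finset ι) (a : ι → ℝ)
    (d : ι → γ) (L : ι → κ → ℝ) :
    0 ≤ ∑ x ∈ s ×ˢ s, if d x.1 = d x.2 then
      a x.1 * a x.2 * Real.sinh (∑ i, L x.1 i * L x.2 i) else 0 := by
  have h : HasSum (fun n : ℕ => ∑ x ∈ s ×ˢ s, if d x.1 = d x.2 then
      a x.1 * a x.2 * ((∑ i, L x.1 i * L x.2 i) ^ (2 * n + 1) / ((2 * n + 1).factorial : ℝ)) else 0)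
      (∑ x ∈ s ×ˢ s, if d x.1 = d x.2 then
      a x.1 * a x.2 * Real.sinh (∑ i, L x.1 i * L x.2 i) else 0) := by
    refine hasSum_sum fun x _ => ?_
    split_ifs
    · exact (Real.hasSum_sinh _).mul_left _
    · exact hasSum_zero
  refine h.nonneg fun n => ?_
  have := psd_pow s a d L (2 * n + 1)
  have h2 := div_nonneg this (Nat.cast_nonneg (α := ℝ) (2 * n + 1).factorial)
  rw [Finset.sum_div] at h2
  refine h2.trans_eq (Finset.sum_congr rfl fun x _ => ?_)
  split_ifs
  · ring
  · simp

lemma psd_tsum {ι κ γ : Type*} [Fintype κ] [Fintype γ] [DecidableEq γ] (a : ι → ℝ)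
    (d : ι → γ) (L : ι → κ → ℝ)
    (hs : Summable fun x : ι × ι => if d x.1 = d x.2 then
      a x.1 * a x.2 * Real.sinh (∑ i, L x.1 i * L x.2 i) else 0) :
    0 ≤ ∑' x : ι × ι, if d x.1 = d x.2 then
      a x.1 * a x.2 * Real.sinh (∑ i, L x.1 i * L x.2 i) else 0 := by
  have := hs.hasSum
  have h2 : Filter.Tendsto (fun s : Finset ι => s ×ˢ s) Filter.atTop Filter.atTop := by
    refine Filter.tendsto_atTop_atTop.2 fun t => ?_
    classical
    refine ⟨t.image Prod.fst ∪ t.image Prod.snd, fun s hs x hx => ?_⟩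
    rw [Finset.mem_product]
    exact ⟨hs (Finset.mem_union_left _ (Finset.mem_image_of_mem _ hx)),
      hs (Finset.mem_union_right _ (Finset.mem_image_of_mem _ hx))⟩
  exact ge_of_tendsto' (Filter.Tendsto.comp this h2) fun s => psd_sinh s a d L

lemma summable_one (a : ℝ) {c : ℝ} (hc : 0 < c) :
    Summable fun n : ℤ => Real.exp (a * n - c * (n:ℝ) ^ 2) := by
  have h := summable_pow_mul_jacobiTheta₂_term_bound (|a| / (2 * Real.pi)) (T := c / Real.pi)
    (by positivity) 0
  refine h.of_nonneg_of_le (fun n => (Real.exp_pos _).le) fun n => ?_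
  rw [pow_zero, one_mul]
  apply Real.exp_le_exp.2
  have h1 : a * n ≤ |a| * |(n:ℝ)| := by rw [← abs_mul]; exact le_abs_self _
  have h2 : -Real.pi * (c / Real.pi * (n:ℝ) ^ 2 - 2 * (|a| / (2 * Real.pi)) * |(n:ℝ)|)
     = |a| * |(n:ℝ)| - c * (n:ℝ) ^ 2 := by
    field_simp
    ring
  push_cast
  rw [h2]
  linarith

lemma summable_pi_prod (k : ℕ) (f : Fin k → ℤ → ℝ) (h0 : ∀ i n, 0 ≤ f i n)
    (hf : ∀ i, Summable (f i)) : Summable fun m : Fin k → ℤ => ∏ i, f i (m i) := by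
  induction k with
  | zero => exact Summable.of_finite
  | succ k ih =>
    have h1 := ih (fun i => f i.succ) (fun i => h0 _) (fun i => hf _)
    have h2 := Summable.mul_of_nonneg (hf 0) h1 (fun n => h0 _ _)
      (fun m => Finset.prod_nonneg fun i _ => h0 _ _)
    rw [← (Fin.consEquiv (fun _ : Fin (k+1) => ℤ)).summable_iff]
    refine h2.congr fun x => ?_
    simp [Fin.prod_univ_succ, Fin.consEquiv]

lemma posDef_lower {k : ℕ} (A : Matrix (Fin k) (Fin k) ℝ) (hA : A.PosDef) :
    ∃ c > 0, ∀ x : Fin k → ℝ, c * ∑ i, x i ^ 2 ≤ ∑ i, ∑ j, x i * A i j * x j := by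
  have hq : ∀ x : Fin k → ℝ, x ≠ 0 → 0 < ∑ i, ∑ j, x i * A i j * x j := by
    intro x hx
    have := hA.dotProduct_mulVec_pos hx
    simpa [dotProduct, Matrix.mulVec, Finset.mul_sum, mul_assoc] using this
  let S : Set (Fin k → ℝ) := {x | ∑ i, x i ^ 2 = 1}
  have hS : IsCompact S := by
    refine Metric.isCompact_of_isClosed_isBounded (isClosed_eq (by fun_prop) (by fun_prop)) ?_
    refine (Metric.isBounded_closedBall (x := (0 : Fin k → ℝ)) (r := 1)).subset fun x hx => ?_
    rw [mem_closedBall_zero_iff, pi_norm_le_iff_of_nonneg zero_le_one]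
    intro i
    have h1 : x i ^ 2 ≤ ∑ i, x i ^ 2 :=
      Finset.single_le_sum (f := fun i => x i ^ 2) (fun i _ => sq_nonneg _) (Finset.mem_univ i)
    rw [show ∑ i, x i ^ 2 = 1 from hx] at h1
    rw [Real.norm_eq_abs]
    exact (sq_le_one_iff_abs_le_one _).1 h1
  obtain ⟨c, hc, hcS⟩ : ∃ c > 0, ∀ x ∈ S, c ≤ ∑ i, ∑ j, x i * A i j * x j := by
    rcases S.eq_empty_or_nonempty with h | h
    · exact ⟨1, one_pos, by simp [h]⟩
    · obtain ⟨x, hx, hmin⟩ := hS.exists_isMinOn h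
        (f := fun x : Fin k → ℝ => ∑ i, ∑ j, x i * A i j * x j) (by fun_prop)
      refine ⟨_, hq x ?_, fun y hy => hmin hy⟩
      rintro rfl
      simp [S] at hx
  refine ⟨c, hc, fun x => ?_⟩
  by_cases hx : x = 0
  · simp [hx]
  have hpos : 0 < ∑ i, x i ^ 2 := by
    obtain ⟨i, hi⟩ := Function.ne_iff.1 hx
    exact Finset.sum_pos' (fun i _ => sq_nonneg _) ⟨i, Finset.mem_univ i, by simpa using pow_pos (abs_pos.2 hi) 2⟩
  set r := Real.sqrt (∑ i, x i ^ 2) with hr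
  have hr0 : 0 < r := Real.sqrt_pos.2 hpos
  have hr2 : r ^ 2 = ∑ i, x i ^ 2 := Real.sq_sqrt hpos.le
  have := hcS (fun i => x i / r) (by
    show ∑ i, (x i / r) ^ 2 = 1
    simp_rw [div_pow, ← Finset.sum_div, ← hr2]
    field_simp)
  rw [← hr2]
  have h2 : ∑ i, ∑ j, x i / r * A i j * (x j / r) = (∑ i, ∑ j, x i * A i j * x j) / r ^ 2 := by
    simp_rw [Finset.sum_div]
    refine Finset.sum_congr rfl fun i _ => Finset.sum_congr rfl fun j _ => ?_
    field_simp
  rw [h2, le_div_iff₀ (by positivity)] at this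
  exact this

lemma summable_gauss {k : ℕ} (A : Matrix (Fin k) (Fin k) ℝ) (hA : A.PosDef) (v : Fin k → ℝ) :
    Summable fun m : Fin k → ℤ => Real.exp (intDot v m) * Real.exp (-(1 / 2) * intQuad A m) := by
  obtain ⟨c, hc, h⟩ := posDef_lower A hA
  have h1 := summable_pi_prod k (fun i n => Real.exp (v i * n - (c / 2) * (n:ℝ) ^ 2))
    (fun _ _ => (Real.exp_pos _).le) (fun i => summable_one _ (by positivity))
  refine h1.of_nonneg_of_le (fun m => by positivity) fun m => ?_
  rw [← Real.exp_add, ← Real.exp_sum]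
  apply Real.exp_le_exp.2
  have h2 := h (fun i => (m i : ℝ))
  rw [Finset.sum_sub_distrib, ← Finset.mul_sum]
  unfold intDot intQuad
  linarith

lemma summable_weight {k : ℕ} (A : Matrix (Fin k) (Fin k) ℝ) (hA : A.PosDef) :
    Summable fun m : Fin k → ℤ => Real.exp (-(1 / 2) * intQuad A m) := by
  refine (summable_gauss A hA 0).congr fun m => ?_
  simp [intDot]

lemma summable_sq {k : ℕ} (A : Matrix (Fin k) (Fin k) ℝ) (hA : A.PosDef) (v : Fin k → ℝ) :
    Summable fun m : Fin k → ℤ => (intDot v m) ^ 2 * Real.exp (-(1 / 2) * intQuad A m) := by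
  have h := ((summable_gauss A hA v).add (summable_gauss A hA (-v))).mul_left 2
  refine h.of_nonneg_of_le (fun m => by positivity) fun m => ?_
  have hneg : intDot (-v) m = - intDot v m := by simp [intDot]
  rw [hneg, ← add_mul, ← mul_assoc]
  refine mul_le_mul_of_nonneg_right ?_ (Real.exp_pos _).le
  set t := intDot v m
  have h1 := Real.quadratic_le_exp_of_nonneg (abs_nonneg t)
  have h2 : Real.exp |t| ≤ Real.exp t + Real.exp (-t) := by
    rcases abs_cases t with ⟨h, _⟩ | ⟨h, _⟩ <;> rw [h]
    · linarith [Real.exp_pos (-t)]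
    · linarith [Real.exp_pos t]
  have h3 := sq_abs t
  nlinarith [abs_nonneg t]

open scoped MatrixOrder in
lemma exists_factor {k : ℕ} (A B : Matrix (Fin k) (Fin k) ℝ)
    (hA : A.PosDef) (hB : B.PosDef)
    (hAB : ∀ x : Fin k → ℝ, ∑ i, ∑ j, x i * A i j * x j ≤
      ∑ i, ∑ j, x i * B i j * x j) :
    ∃ C : Matrix (Fin k) (Fin k) ℝ, ∀ m : Fin k → ℤ,
      ∑ i, (intDot (C i) m) ^ 2 = intQuad B m - intQuad A m := by
  have hq : ∀ (M : Matrix (Fin k) (Fin k) ℝ) (x : Fin k → ℝ),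
      x ⬝ᵥ M.mulVec x = ∑ i, ∑ j, x i * M i j * x j := fun M x => by
    simp [dotProduct, Matrix.mulVec, Finset.mul_sum, mul_assoc]
  have hW : (B - A).PosSemidef := by
    refine .of_dotProduct_mulVec_nonneg (hB.1.sub hA.1) fun x => ?_
    rw [star_trivial, Matrix.sub_mulVec, dotProduct_sub, hq, hq]
    linarith [hAB x]
  obtain ⟨C, hC⟩ := CStarAlgebra.nonneg_iff_eq_star_mul_self.mp hW.nonneg
  refine ⟨C, fun m => ?_⟩
  have h1 : ∑ i, (intDot (C i) m) ^ 2 =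
      (fun i => (m i : ℝ)) ⬝ᵥ (B - A).mulVec (fun i => (m i : ℝ)) := by
    rw [hC, ← Matrix.mulVec_mulVec, Matrix.dotProduct_mulVec, Matrix.star_eq_conjTranspose,
      Matrix.vecMul_conjTranspose, star_trivial, star_trivial]
    simp [dotProduct, Matrix.mulVec, intDot, sq]
  rw [h1, Matrix.sub_mulVec, dotProduct_sub, hq, hq]
  rfl

lemma intDot_add {k : ℕ} (v : Fin k → ℝ) (m n : Fin k → ℤ) :
    intDot v (m + n) = intDot v m + intDot v n := by
  simp [intDot, mul_add, Finset.sum_add_distrib]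

lemma intDot_sub {k : ℕ} (v : Fin k → ℝ) (m n : Fin k → ℤ) :
    intDot v (m - n) = intDot v m - intDot v n := by
  simp [intDot, mul_sub, Finset.sum_sub_distrib]

lemma intQuad_par {k : ℕ} (A : Matrix (Fin k) (Fin k) ℝ) (m n : Fin k → ℤ) :
    intQuad A (m + n) + intQuad A (m - n) = 2 * intQuad A m + 2 * intQuad A n := by
  unfold intQuad
  simp_rw [Finset.mul_sum, ← Finset.sum_add_distrib]
  refine Finset.sum_congr rfl fun i _ => Finset.sum_congr rfl fun j _ => ?_
  simp only [Pi.add_apply, Pi.sub_apply]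
  push_cast
  ring

lemma core {k : ℕ} (A B : Matrix (Fin k) (Fin k) ℝ)
    (hA : A.PosDef) (hB : B.PosDef)
    (hAB : ∀ x : Fin k → ℝ, ∑ i, ∑ j, x i * A i j * x j ≤
      ∑ i, ∑ j, x i * B i j * x j) (α : (Fin k → ℤ) → ℝ)
    (F : (Fin k → ℤ) × (Fin k → ℤ) → ℝ)
    (hF : ∀ x, F x = α (x.1 + x.2) * α (x.1 - x.2) *
      (Real.exp (-(1 / 2) * intQuad A x.1) * Real.exp (-(1 / 2) * intQuad B x.2) -
       Real.exp (-(1 / 2) * intQuad B x.1) * Real.exp (-(1 / 2) * intQuad A x.2)))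
    (hs : Summable F) : 0 ≤ ∑' x, F x := by
  obtain ⟨C, hC⟩ := exists_factor A B hA hB hAB
  let a : (Fin k → ℤ) → ℝ := fun p => α p * Real.exp (-(1 / 8) * (intQuad A p + intQuad B p))
  let d : (Fin k → ℤ) → (Fin k → ZMod 2) := fun p i => (p i : ZMod 2)
  let L : (Fin k → ℤ) → Fin k → ℝ := fun p i => (1 / 2) * intDot (C i) p
  let T : (Fin k → ℤ) × (Fin k → ℤ) → ℝ := fun x => if d x.1 = d x.2 then
      a x.1 * a x.2 * Real.sinh (∑ i, L x.1 i * L x.2 i) else 0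
  let g : (Fin k → ℤ) × (Fin k → ℤ) → (Fin k → ℤ) × (Fin k → ℤ) := fun x => (x.1 + x.2, x.1 - x.2)
  have hg : Function.Injective g := by
    rintro ⟨m, n⟩ ⟨m', n'⟩ h
    simp only [g, Prod.mk.injEq] at h
    obtain ⟨h1, h2⟩ := h
    have h3 : ∀ i, m i = m' i ∧ n i = n' i := fun i => by
      have e1 := congrFun h1 i
      have e2 := congrFun h2 i
      simp only [Pi.add_apply, Pi.sub_apply] at e1 e2
      omega
    exact Prod.ext (funext fun i => (h3 i).1) (funext fun i => (h3 i).2)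
  have hrange : ∀ x ∉ Set.range g, T x = 0 := by
    rintro ⟨p, q⟩ hx
    refine if_neg fun h => hx ?_
    have h3 : ∀ i, (2 : ℤ) ∣ q i - p i := fun i =>
      (ZMod.intCast_eq_intCast_iff_dvd_sub (p i) (q i) 2).1 (congrFun h i)
    choose r hr using h3
    refine ⟨(fun i => p i + r i, fun i => - r i), ?_⟩
    refine Prod.ext (funext fun i => ?_) (funext fun i => ?_)
    · simp [g]
    · have := hr i
      simp only [g, Pi.sub_apply]
      omega
  have hFT : ∀ x, F x = 2 * T (g x) := by
    rintro ⟨m, n⟩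
    have hd : d (m + n) = d (m - n) := by
      funext i
      refine (ZMod.intCast_eq_intCast_iff_dvd_sub _ _ 2).2 ⟨- n i, ?_⟩
      simp only [Pi.add_apply, Pi.sub_apply]
      push_cast
      ring
    have hL : ∑ i, L (m + n) i * L (m - n) i = 1 / 4 * ((intQuad B m - intQuad A m) -
        (intQuad B n - intQuad A n)) := by
      rw [← hC, ← hC, ← Finset.sum_sub_distrib, Finset.mul_sum]
      refine Finset.sum_congr rfl fun i _ => ?_
      simp only [L, intDot_add, intDot_sub]
      ring
    rw [hF]
    simp only [T, g, hd, if_true, hL, a]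
    have hpA := intQuad_par A m n
    have hpB := intQuad_par B m n
    have key : Real.exp (-(1 / 2) * intQuad A m) * Real.exp (-(1 / 2) * intQuad B n) -
       Real.exp (-(1 / 2) * intQuad B m) * Real.exp (-(1 / 2) * intQuad A n) =
       2 * (Real.exp (-(1 / 8) * (intQuad A (m + n) + intQuad B (m + n))) *
         Real.exp (-(1 / 8) * (intQuad A (m - n) + intQuad B (m - n))) *
         Real.sinh (1 / 4 * ((intQuad B m - intQuad A m) - (intQuad B n - intQuad A n)))) := by
      rw [Real.sinh_eq, ← Real.exp_add, ← Real.exp_add, ← Real.exp_add, mul_div_assoc',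
        mul_div_cancel₀ _ two_ne_zero, mul_sub, ← Real.exp_add, ← Real.exp_add]
      congr 2 <;> linarith
    rw [key]
    ring
  have hsT : Summable T := by
    rw [← hg.summable_iff hrange]
    refine (hs.div_const 2).congr fun x => ?_
    rw [hFT]; simp
  have hnn : 0 ≤ ∑' x, T x := psd_tsum a d L hsT
  have heq : ∑' x, T (g x) = ∑' x, T x := hg.tsum_eq fun x hx => by
    by_contra h
    exact hx (hrange x h)
  rw [tsum_congr hFT, tsum_mul_left, heq]
  positivity

lemma tsum_pair {ι : Type*} {f g : ι → ℝ} (hf : Summable f) (hg : Summable g)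
    (hf0 : ∀ x, 0 ≤ f x) (hg0 : ∀ x, 0 ≤ g x) :
    HasSum (fun x : ι × ι => f x.1 * g x.2) ((∑' x, f x) * ∑' x, g x) :=
  hf.hasSum.mul hg.hasSum (hf.mul_of_nonneg hg hf0 hg0)

/-- Regev–Stephens-Davidowitz inequality for Gaussians on lattices: if `A ≤ B`
in the sense of quadratic forms, with `A, B` positive definite, then for every
`v ∈ ℝ^k` the Laplace transform of the integer Gaussian for `B` is dominated by
that for `A`; in particular the second moments are ordered the same way. -/
theorem integer_gaussian_comparison {k : ℕ} (A B : Matrix (Fin k) (Fin k) ℝ)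
    (hA : A.PosDef) (hB : B.PosDef)
    (hAB : ∀ x : Fin k → ℝ, ∑ i, ∑ j, x i * A i j * x j ≤
      ∑ i, ∑ j, x i * B i j * x j)
    (v : Fin k → ℝ) :
    intGaussExp B (fun m => Real.exp (intDot v m)) ≤
        intGaussExp A (fun m => Real.exp (intDot v m)) ∧
      intGaussExp B (fun m => (intDot v m) ^ 2) ≤
        intGaussExp A (fun m => (intDot v m) ^ 2) := by
  have pA : ∀ m, 0 ≤ Real.exp (-(1 / 2) * intQuad A m) := fun m => (Real.exp_pos _).le
  have pB : ∀ m, 0 ≤ Real.exp (-(1 / 2) * intQuad B m) := fun m => (Real.exp_pos _).le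
  have wA := summable_weight A hA
  have wB := summable_weight B hB
  have zA : 0 < ∑' m : Fin k → ℤ, Real.exp (-(1 / 2) * intQuad A m) :=
    wA.tsum_pos pA 0 (Real.exp_pos _)
  have zB : 0 < ∑' m : Fin k → ℤ, Real.exp (-(1 / 2) * intQuad B m) :=
    wB.tsum_pos pB 0 (Real.exp_pos _)
  constructor
  · unfold intGaussExp
    rw [div_le_div_iff₀ zB zA]
    have eA := summable_gauss A hA v
    have eB := summable_gauss B hB v
    have h := (tsum_pair eA wB (fun _ => by positivity) pB).sub
      (tsum_pair eB wA (fun _ => by positivity) pA)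
    have hc := core A B hA hB hAB (fun p => Real.exp (1 / 2 * intDot v p)) _ (fun x => by
      rw [intDot_add, intDot_sub,
        ← Real.exp_add (1 / 2 * (intDot v x.1 + intDot v x.2))]
      have : 1 / 2 * (intDot v x.1 + intDot v x.2) + 1 / 2 * (intDot v x.1 - intDot v x.2)
        = intDot v x.1 := by ring
      rw [this]
      ring) h.summable
    rw [h.tsum_eq] at hc
    linarith
  · unfold intGaussExp
    rw [div_le_div_iff₀ zB zA]
    have eA := summable_sq A hA v
    have eB := summable_sq B hB v
    have h := ((tsum_pair eA wB (fun _ => by positivity) pB).sub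
      (tsum_pair eB wA (fun _ => by positivity) pA)).sub
      ((tsum_pair wA eB pA (fun _ => by positivity)).sub
      (tsum_pair wB eA pB (fun _ => by positivity)))
    have hc := core A B hA hB hAB (fun p => intDot v p) _ (fun x => by
      rw [intDot_add, intDot_sub]
      ring) h.summable
    rw [h.tsum_eq] at hc
    linarith
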